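/- Let 𝒞 be a partition of V and 0 < t ≤ 1. Then Q_t(𝒞) ≥ (−t/2)·(1 − m_E(D(𝒞))). -/

import Mathlib

open Finset

variable {V : Type*} [Fintype V] [DecidableEq V]

noncomputable section

/-- `Z = ∑_{l,r} m(l,r)` as a real number. -/
def Zval (m : V → V → ℕ) : ℝ := ∑ l : V, ∑ r : V, (m l r : ℝ)

/-- The probability measure `m_E` on `V × V`. -/
def mE (m : V → V → ℕ) (S : Finset (V × V)) : ℝ :=
  (∑ p ∈ S, (m p.1 p.2 : ℝ)) / Zval m

/-- The marginal probability `m_V` on `V`. -/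
def mV (m : V → V → ℕ) (A : Finset V) : ℝ := mE m (A ×ˢ Finset.univ)

/-- The product measure `m_VV` on `V × V`. -/
def mVV (m : V → V → ℕ) (S : Finset (V × V)) : ℝ :=
  ∑ p ∈ S, mV m {p.1} * mV m {p.2}

/-- The signed measure `μ_t = m_E - t · m_VV`. -/
def mu (m : V → V → ℕ) (t : ℝ) (S : Finset (V × V)) : ℝ := mE m S - t * mVV m S

/-- `ρ(C) = m_E(C × (V ∖ C))`. -/
def rho (m : V → V → ℕ) (C : Finset V) : ℝ := mE m (C ×ˢ (Finset.univ \ C))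

/-- A partition of `V`: pairwise disjoint nonempty sets covering `V`. -/
def IsPartition (𝒞 : Finset (Finset V)) : Prop :=
  (∀ C ∈ 𝒞, C.Nonempty) ∧
  (∀ C ∈ 𝒞, ∀ C' ∈ 𝒞, C ≠ C' → Disjoint C C') ∧
  𝒞.sup id = Finset.univ

/-- The diagonal set `D(𝒞) = ∪_{C ∈ 𝒞} C × C`. -/
def Dset (𝒞 : Finset (Finset V)) : Finset (V × V) := 𝒞.sup fun C => C ×ˢ C

/-- The modularity at resolution `t`: `Q_t(𝒞) = μ_t(D(𝒞))`. -/
def Qmod (m : V → V → ℕ) (t : ℝ) (𝒞 : Finset (Finset V)) : ℝ := mu m t (Dset 𝒞)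

/-- The complement `Q̄_t(𝒞) = μ_t(D̄(𝒞))`. -/
def Qbar (m : V → V → ℕ) (t : ℝ) (𝒞 : Finset (Finset V)) : ℝ :=
  mu m t (Finset.univ \ Dset 𝒞)

/-- `𝒞` is submodular for `μ_t`: `μ_t(C × C') ≤ 0` for distinct `C, C' ∈ 𝒞`. -/
def Submodular (m : V → V → ℕ) (t : ℝ) (𝒞 : Finset (Finset V)) : Prop :=
  ∀ C ∈ 𝒞, ∀ C' ∈ 𝒞, C ≠ C' → mu m t (C ×ˢ C') ≤ 0

/-- `Coarsens 𝒞 𝒟` means `𝒞 ⪯ 𝒟`, i.e. `𝒟` refines `𝒞`: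
every element of `𝒞` is the union of the elements of `𝒟` it contains. -/
def Coarsens (𝒞 𝒟 : Finset (Finset V)) : Prop :=
  ∀ C ∈ 𝒞, C = (𝒟.filter fun D => D ⊆ C).sup id

/-- The resolution `t(𝒞)`: the maximum of `m_E(C×C') / m_VV(C×C')` over distinct
pairs of parts (`0` when there are no such pairs, e.g. `|𝒞| = 1`). -/
def resol (m : V → V → ℕ) (𝒞 : Finset (Finset V)) : ℝ :=
  ⨆ p : {p : Finset V × Finset V // p.1 ∈ 𝒞 ∧ p.2 ∈ 𝒞 ∧ p.1 ≠ p.2},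
    mE m ((p : Finset V × Finset V).1 ×ˢ (p : Finset V × Finset V).2) /
      mVV m ((p : Finset V × Finset V).1 ×ˢ (p : Finset V × Finset V).2)

/-- The graph `G` associated to `m`: an edge between `l ≠ r` iff `m(l,r) > 0`
(for symmetric `m` this is exactly the graph of the paper). -/
def graphOf (m : V → V → ℕ) : SimpleGraph V :=
  SimpleGraph.fromRel fun l r => 0 < m l r

/-- `α(𝒞) = m_VV(D(𝒞)) = ∑_{C ∈ 𝒞} m_V(C)²`. -/
def alphaP (m : V → V → ℕ) (𝒞 : Finset (Finset V)) : ℝ := mVV m (Dset 𝒞)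

open scoped Classical in
/-- `Z₀(𝒞)` at resolution `t`: the pairs of distinct parts with `μ_t(C × C') = 0`. -/
def Z0 (m : V → V → ℕ) (t : ℝ) (𝒞 : Finset (Finset V)) :
    Finset (Finset V × Finset V) :=
  (𝒞 ×ˢ 𝒞).filter fun p => p.1 ≠ p.2 ∧ mu m t (p.1 ×ˢ p.2) = 0

/-- The value `c*` of the minimum cut of `G` with weights `m`. -/
def mincut (m : V → V → ℕ) : ℝ :=
  ⨅ S : {S : Finset V // S.Nonempty ∧ S ≠ Finset.univ},
    ∑ l ∈ (S : Finset V), ∑ r ∈ Finset.univ \ (S : Finset V), (m l r : ℝ)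

end

theorem mE_nonneg (m : V → V → ℕ) (S : Finset (V × V)) : 0 ≤ mE m S := by
  unfold mE Zval
  positivity

theorem mE_mono (m : V → V → ℕ) {S T : Finset (V × V)} (h : S ⊆ T) : mE m S ≤ mE m T := by
  unfold mE
  have hZ : 0 ≤ Zval m := by unfold Zval; positivity
  gcongr

theorem mE_union (m : V → V → ℕ) {S T : Finset (V × V)} (h : Disjoint S T) :
    mE m (S ∪ T) = mE m S + mE m T := by
  unfold mE
  rw [Finset.sum_union h, add_div]

theorem mE_univ (m : V → V → ℕ) (hZ : 0 < Zval m) : mE m Finset.univ = 1 := by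
  unfold mE
  rw [Fintype.sum_prod_type]
  exact div_self hZ.ne'

theorem mE_biUnion (m : V → V → ℕ) {ι : Type*} (s : Finset ι)
    (f : ι → Finset (V × V)) (h : (s : Set ι).PairwiseDisjoint f) :
    mE m (s.biUnion f) = ∑ i ∈ s, mE m (f i) := by
  unfold mE
  rw [Finset.sum_biUnion h, Finset.sum_div]

theorem mE_swap (m : V → V → ℕ) (hsym : ∀ l r, m l r = m r l) (A B : Finset V) :
    mE m (A ×ˢ B) = mE m (B ×ˢ A) := by
  unfold mE
  rw [Finset.sum_product, Finset.sum_product_right]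
  simp only [hsym]

theorem mV_eq_sum (m : V → V → ℕ) (A : Finset V) : mV m A = ∑ l ∈ A, mV m {l} := by
  simp only [mV, mE, Finset.sum_product, Finset.sum_singleton, Finset.sum_div]

theorem mVV_product (m : V → V → ℕ) (A B : Finset V) :
    mVV m (A ×ˢ B) = mV m A * mV m B := by
  rw [mV_eq_sum m A, mV_eq_sum m B, Finset.sum_mul_sum, mVV, Finset.sum_product]

theorem mV_eq_add_rho (m : V → V → ℕ) (C : Finset V) :
    mV m C = mE m (C ×ˢ C) + rho m C := by
  rw [mV, rho, ← mE_union]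
  · rw [← Finset.product_union, Finset.union_sdiff_of_subset (Finset.subset_univ C)]
  · exact Finset.disjoint_product.mpr (Or.inr Finset.disjoint_sdiff)

theorem mE_add_two_mul_rho_le_one (m : V → V → ℕ) (hsym : ∀ l r, m l r = m r l)
    (hZ : 0 < Zval m) (C : Finset V) : mE m (C ×ˢ C) + 2 * rho m C ≤ 1 := by
  have h : mE m (C ×ˢ Finset.univ ∪ (Finset.univ \ C) ×ˢ C) ≤ 1 :=
    (mE_mono m (Finset.subset_univ _)).trans_eq (mE_univ m hZ)
  rw [mE_union m (Finset.disjoint_product.mpr (Or.inl Finset.disjoint_sdiff)),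
    mE_swap m hsym (Finset.univ \ C) C] at h
  have h' := mV_eq_add_rho m C
  unfold mV rho at *
  linarith

theorem IsPartition.pairwiseDisjoint {𝒞 : Finset (Finset V)} (h : IsPartition 𝒞) :
    (𝒞 : Set (Finset V)).PairwiseDisjoint id :=
  fun C hC C' hC' hne => h.2.1 C hC C' hC' hne

theorem IsPartition.pairwiseDisjoint_product {𝒞 : Finset (Finset V)} (h : IsPartition 𝒞) :
    (𝒞 : Set (Finset V)).PairwiseDisjoint fun C => C ×ˢ C :=
  fun C hC C' hC' hne => Finset.disjoint_product.mpr (Or.inl (h.2.1 C hC C' hC' hne))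

theorem IsPartition.mE_Dset (m : V → V → ℕ) {𝒞 : Finset (Finset V)} (h : IsPartition 𝒞) :
    mE m (Dset 𝒞) = ∑ C ∈ 𝒞, mE m (C ×ˢ C) := by
  rw [Dset, Finset.sup_eq_biUnion, mE_biUnion m _ _ h.pairwiseDisjoint_product]

theorem IsPartition.mVV_Dset (m : V → V → ℕ) {𝒞 : Finset (Finset V)} (h : IsPartition 𝒞) :
    mVV m (Dset 𝒞) = ∑ C ∈ 𝒞, mV m C ^ 2 := by
  rw [Dset, Finset.sup_eq_biUnion, mVV, Finset.sum_biUnion h.pairwiseDisjoint_product]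
  exact Finset.sum_congr rfl fun C _ => (mVV_product m C C).trans (sq _).symm

theorem IsPartition.sum_mV (m : V → V → ℕ) (hZ : 0 < Zval m) {𝒞 : Finset (Finset V)}
    (h : IsPartition 𝒞) : ∑ C ∈ 𝒞, mV m C = 1 := by
  have huniv : mV m Finset.univ = 1 := by
    rw [mV, Finset.univ_product_univ, mE_univ m hZ]
  rw [← huniv, mV_eq_sum m Finset.univ, ← h.2.2, Finset.sup_eq_biUnion,
    Finset.sum_biUnion h.pairwiseDisjoint]
  exact Finset.sum_congr rfl fun C _ => mV_eq_sum m C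

theorem mul_sq_add_le {a r t : ℝ} (ha : 0 ≤ a) (hr : 0 ≤ r) (har : a + 2 * r ≤ 1)
    (ht : 0 ≤ t) (ht1 : t ≤ 1) : t * (a + r) ^ 2 ≤ a + t / 2 * r := by
  have h : (a + r) ^ 2 ≤ a + r / 2 := by
    nlinarith [mul_nonneg ha hr, mul_nonneg (by positivity : 0 ≤ a + r / 2) (sub_nonneg.mpr har)]
  nlinarith [mul_le_mul_of_nonneg_left h ht, mul_nonneg ha (sub_nonneg.mpr ht1)]

/-- For a partition `𝒞` of `V` and `0 < t ≤ 1`,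
`Q_t(𝒞) ≥ (−t/2)·(1 − m_E(D(𝒞)))`. -/
theorem stmt_10 (m : V → V → ℕ) (hsym : ∀ l r, m l r = m r l)
    (hZ : 0 < ∑ l : V, ∑ r : V, m l r) (hdeg : ∀ l : V, 0 < ∑ r : V, m l r)
    (𝒞 : Finset (Finset V)) (h𝒞 : IsPartition 𝒞) (t : ℝ) (ht : 0 < t) (ht1 : t ≤ 1) :
    (-t / 2) * (1 - mE m (Dset 𝒞)) ≤ Qmod m t 𝒞 := by
  have hZ' : 0 < Zval m := by
    unfold Zval
    exact_mod_cast hZ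
  have hsum : ∑ C ∈ 𝒞, t * mV m C ^ 2 ≤ ∑ C ∈ 𝒞, (mE m (C ×ˢ C) + t / 2 * rho m C) :=
    Finset.sum_le_sum fun C _ => by
      rw [mV_eq_add_rho]
      exact mul_sq_add_le (mE_nonneg m _) (mE_nonneg m _)
        (mE_add_two_mul_rho_le_one m hsym hZ' C) ht.le ht1
  have hone := h𝒞.sum_mV m hZ'
  simp only [mV_eq_add_rho, Finset.sum_add_distrib] at hone
  rw [Finset.sum_add_distrib, ← Finset.mul_sum, ← Finset.mul_sum, ← h𝒞.mVV_Dset,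
    ← h𝒞.mE_Dset] at hsum
  rw [← h𝒞.mE_Dset, ← eq_sub_iff_add_eq'] at hone
  rw [hone] at hsum
  unfold Qmod mu
  linarith
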